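/- arXiv:2404.14235 — 2 statements merged into one kernel-verified Lean document; each statement's English description precedes it below -/
import Mathlib

section
/- Let E be a labeled graph on node set Fin n over alphabet Fin σ in which every node has at least one incoming edge. Fix a node u and suppose γ is a least upper bound of I_u with respect to the lexicographic order (IsLUB of I_u over the linear order whose strict part is ≺). Then there exists a node v such that (v, u, γ 0) ∈ E and the tail of γ is a least upper bound of I_v. -/
/-- Strict lexicographic order on ω-strings over `Fin σ`. -/
def OmegaLt {σ : ℕ} (α β : ℕ → Fin σ) : Prop :=
  ∃ k : ℕ, (∀ j, j < k → α j = β j) ∧ α k < β k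

/-- Reflexive closure of the strict lexicographic order. -/
def OmegaLe {σ : ℕ} (α β : ℕ → Fin σ) : Prop := OmegaLt α β ∨ α = β

/-- Length of the longest common prefix: least `k` with `α k ≠ β k`. -/
noncomputable def lcp {σ : ℕ} (α β : ℕ → Fin σ) : ℕ := sInf {k | α k ≠ β k}

/-- Tail of an ω-string. -/
def tail {σ : ℕ} (α : ℕ → Fin σ) : ℕ → Fin σ := fun i => α (i + 1)

/-- The set of ω-strings labeling infinite backward walks from node `u`. -/
def Iset {n σ : ℕ} (E : Set (Fin n × Fin n × Fin σ)) (u : Fin n) : Set (ℕ → Fin σ) :=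
  {γ | ∃ f : ℕ → Fin n, f 0 = u ∧ ∀ i : ℕ, (f (i + 1), f i, γ i) ∈ E}

/-- `γ` is a least upper bound of `S` w.r.t. the lexicographic order. -/
def IsLUBOmega {σ : ℕ} (S : Set (ℕ → Fin σ)) (γ : ℕ → Fin σ) : Prop :=
  (∀ δ ∈ S, OmegaLe δ γ) ∧ ∀ β : ℕ → Fin σ, (∀ δ ∈ S, OmegaLe δ β) → OmegaLe γ β

theorem omegaLt_iff {σ : ℕ} (a b : ℕ → Fin σ) : OmegaLt a b ↔ toLex a < toLex b := Iff.rfl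

theorem omegaLe_iff {σ : ℕ} (a b : ℕ → Fin σ) : OmegaLe a b ↔ toLex a ≤ toLex b := by
  rw [le_iff_lt_or_eq]
  exact Iff.or (omegaLt_iff a b) toLex.injective.eq_iff.symm

/-- Prepend a letter. -/
def pcons {σ : ℕ} (c : Fin σ) (a : ℕ → Fin σ) : ℕ → Fin σ
  | 0 => c
  | i + 1 => a i

theorem pcons_tail {σ : ℕ} (a : ℕ → Fin σ) : pcons (a 0) (tail a) = a := by
  funext i; cases i <;> rfl

theorem pcons_lt {σ : ℕ} (c : Fin σ) (a b : ℕ → Fin σ) :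
    OmegaLt (pcons c a) (pcons c b) ↔ OmegaLt a b := by
  constructor
  · rintro ⟨k, h1, h2⟩
    cases k with
    | zero => exact absurd h2 (lt_irrefl _)
    | succ k => exact ⟨k, fun j hj => h1 (j + 1) (by omega), h2⟩
  · rintro ⟨k, h1, h2⟩
    refine ⟨k + 1, fun j hj => ?_, h2⟩
    cases j with
    | zero => rfl
    | succ j => exact h1 j (by omega)

theorem pcons_le {σ : ℕ} (c : Fin σ) (a b : ℕ → Fin σ) :
    OmegaLe (pcons c a) (pcons c b) ↔ OmegaLe a b := by
  refine Iff.or (pcons_lt c a b) ⟨fun h => ?_, fun h => by rw [h]⟩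
  funext i
  exact congrFun h (i + 1)

theorem pcons_mem {n σ : ℕ} {E : Set (Fin n × Fin n × Fin σ)} {u v : Fin n} {c : Fin σ}
    (h : (v, u, c) ∈ E) {a : ℕ → Fin σ} (ha : a ∈ Iset E v) : pcons c a ∈ Iset E u := by
  obtain ⟨f, hf0, hf⟩ := ha
  refine ⟨fun i => match i with | 0 => u | i + 1 => f i, rfl, fun i => ?_⟩
  cases i with
  | zero => simpa [pcons, hf0] using h
  | succ i => exact hf i

theorem tail_mem {n σ : ℕ} {E : Set (Fin n × Fin n × Fin σ)} {u : Fin n}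
    {a : ℕ → Fin σ} (ha : a ∈ Iset E u) : ∃ v, (v, u, a 0) ∈ E ∧ tail a ∈ Iset E v := by
  obtain ⟨f, hf0, hf⟩ := ha
  exact ⟨f 1, hf0 ▸ hf 0, fun i => f (i + 1), rfl, fun i => hf (i + 1)⟩

theorem Iset_nonempty {n σ : ℕ} {E : Set (Fin n × Fin n × Fin σ)}
    (hE : ∀ u : Fin n, ∃ v c, (v, u, c) ∈ E) (u : Fin n) : ∃ a, a ∈ Iset E u := by
  choose p c h using hE
  refine ⟨fun i => c (p^[i] u), fun i => p^[i] u, rfl, fun i => ?_⟩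
  simp only [Function.iterate_succ_apply']
  exact h _

theorem head_le {σ : ℕ} {a b : ℕ → Fin σ} (h : OmegaLe a b) : a 0 ≤ b 0 := by
  rcases h with ⟨k, h1, h2⟩ | h
  · cases k with
    | zero => exact h2.le
    | succ k => exact (h1 0 (by omega)).le
  · rw [h]

/-- In a source-free labeled graph, the supremum string of a node `u` starts with a character
`γ 0` labeling an edge `(v, u, γ 0)` such that `tail γ` is the supremum string of `v`. -/
theorem stmt_5 (n σ : ℕ) [NeZero n] [NeZero σ]
    (E : Set (Fin n × Fin n × Fin σ))
    (hE : ∀ u : Fin n, ∃ v c, (v, u, c) ∈ E)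
    (u : Fin n) (γ : ℕ → Fin σ) (hγ : IsLUBOmega (Iset E u) γ) :
    ∃ v : Fin n, (v, u, γ 0) ∈ E ∧ IsLUBOmega (Iset E v) (tail γ) := by
  have hub : ∀ v, (v, u, γ 0) ∈ E → ∀ δ ∈ Iset E v, OmegaLe δ (tail γ) := by
    intro v hv δ hδ
    have := hγ.1 _ (pcons_mem hv hδ)
    rw [← pcons_tail γ] at this
    exact (pcons_le _ _ _).1 this
  by_cases hex : ∃ v, (v, u, γ 0) ∈ E
  · by_contra hcon
    have hb : ∀ v, ∃ β : ℕ → Fin σ, (v, u, γ 0) ∈ E →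
        (∀ δ ∈ Iset E v, OmegaLe δ β) ∧ ¬ OmegaLe (tail γ) β := by
      intro v
      by_cases hv : (v, u, γ 0) ∈ E
      · by_contra h
        push Not at h
        exact hcon ⟨v, hv, hub v hv, fun β hβ => by
          by_contra h3
          exact h3 ((h β).2 hβ)⟩
      · exact ⟨γ, fun h => absurd h hv⟩
    choose β hβ using hb
    classical
    obtain ⟨w, hw, hmax⟩ := Finset.exists_max_image
      (Finset.univ.filter fun v => (v, u, γ 0) ∈ E) (fun v => toLex (β v))
      (by obtain ⟨v, hv⟩ := hex; exact ⟨v, by simpa using hv⟩)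
    have hw' : (w, u, γ 0) ∈ E := by simpa using hw
    apply (hβ w hw').2
    rw [← pcons_le (γ 0), pcons_tail]
    apply hγ.2
    intro δ hδ
    rcases lt_or_eq_of_le (head_le (hγ.1 δ hδ)) with h | h
    · exact Or.inl ⟨0, fun j hj => absurd hj (by omega), h⟩
    · obtain ⟨v, hv, ht⟩ := tail_mem hδ
      rw [h] at hv
      rw [← pcons_tail δ, h, pcons_le, omegaLe_iff]
      exact le_trans ((omegaLe_iff _ _).1 ((hβ v hv).1 _ ht)) (hmax v (by simpa using hv))
  · exfalso
    have hlt : ∀ δ ∈ Iset E u, δ 0 < γ 0 := by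
      intro δ hδ
      refine lt_of_le_of_ne (head_le (hγ.1 δ hδ)) fun h => hex ?_
      obtain ⟨v, hv, -⟩ := tail_mem hδ
      exact ⟨v, h ▸ hv⟩
    have hpos : 0 < (γ 0).val := by
      obtain ⟨a, ha⟩ := Iset_nonempty hE u
      have := hlt a ha
      rw [Fin.lt_def] at this
      omega
    have hs := (γ 0).isLt
    let c : Fin σ := ⟨(γ 0).val - 1, by omega⟩
    let m : Fin σ := ⟨σ - 1, by omega⟩
    have h := head_le (hγ.2 (pcons c fun _ => m) ?_)
    · have h' : (γ 0).val ≤ (γ 0).val - 1 := h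
      omega
    · intro δ hδ
      have h1 := hlt δ hδ
      rw [Fin.lt_def] at h1
      have hle : δ 0 ≤ c := by
        rw [Fin.le_def]; change _ ≤ (γ 0).val - 1; omega
      rw [omegaLe_iff]
      by_contra h2
      rw [not_le] at h2
      replace h2 := (omegaLt_iff _ _).2 h2
      obtain ⟨k, -, hk⟩ := h2
      cases k with
      | zero => exact absurd hk (not_lt.2 hle)
      | succ k =>
        have h3 : σ - 1 < (δ (k + 1)).val := hk
        have := (δ (k + 1)).isLt
        omega
end

section
/- Let n, σ be positive integers and let E be a labeled graph on node set Fin n over alphabet Fin σ in which every node has at least one incoming edge. Then for every node u, the set I_u of ω-strings labeling infinite backward walks from u is nonempty and contains both a least element and a greatest element with respect to the lexicographic order. (Hence the infimum string inf_u and the supremum string sup_u of a finite source-free labeled graph are well-defined ω-strings and are attained by actual backward walks.) -/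
theorem aux_Iset_compact {n σ : ℕ} (E : Set (Fin n × Fin n × Fin σ)) (u : Fin n) :
    IsCompact (Iset E u) := by
  have hc : IsClosed {p : (ℕ → Fin n) × (ℕ → Fin σ) |
      p.1 0 = u ∧ ∀ i : ℕ, (p.1 (i + 1), p.1 i, p.2 i) ∈ E} := by
    have h1 : IsClosed {p : (ℕ → Fin n) × (ℕ → Fin σ) | p.1 0 = u} :=
      isClosed_eq (by fun_prop) continuous_const
    have h2 : ∀ i : ℕ, IsClosed {p : (ℕ → Fin n) × (ℕ → Fin σ) |
        (p.1 (i + 1), p.1 i, p.2 i) ∈ E} := fun i =>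
      (isClosed_discrete E).preimage
        (f := fun p : (ℕ → Fin n) × (ℕ → Fin σ) => (p.1 (i + 1), p.1 i, p.2 i)) (by fun_prop)
    have h3 := h1.inter (isClosed_iInter h2)
    convert h3 using 1
    ext p
    simp
  have := hc.isCompact.image continuous_snd
  convert this using 1
  ext γ
  simp [Iset]

theorem aux_open {σ : ℕ} (P : Fin σ → Fin σ → Prop) (δ : ℕ → Fin σ) :
    IsOpen {γ : ℕ → Fin σ | ∃ k : ℕ, (∀ j, j < k → δ j = γ j) ∧ P (δ k) (γ k)} := by
  have : {γ : ℕ → Fin σ | ∃ k : ℕ, (∀ j, j < k → δ j = γ j) ∧ P (δ k) (γ k)} =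
      ⋃ k : ℕ, ((⋂ j ∈ Set.Iio k, {γ : ℕ → Fin σ | δ j = γ j}) ∩ {γ | P (δ k) (γ k)}) := by
    ext γ; simp
  rw [this]
  refine isOpen_iUnion fun k => IsOpen.inter ?_ ?_
  · refine (Set.finite_Iio k).isOpen_biInter fun j _ => ?_
    exact (isOpen_discrete {a | δ j = a}).preimage (continuous_apply j)
  · exact (isOpen_discrete {a | P (δ k) a}).preimage (continuous_apply k)

theorem aux_nonempty {n σ : ℕ} (E : Set (Fin n × Fin n × Fin σ))
    (hE : ∀ u : Fin n, ∃ v c, (v, u, c) ∈ E) (u : Fin n) : (Iset E u).Nonempty := by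
  choose v c h using hE
  refine ⟨fun i => c (v^[i] u), fun i => v^[i] u, rfl, fun i => ?_⟩
  simp only [Function.iterate_succ_apply']
  exact h _

theorem aux_le {σ : ℕ} {α β : ℕ → Fin σ} (h : toLex α ≤ toLex β) : OmegaLe α β := by
  rcases h.lt_or_eq with h | h
  · exact Or.inl h
  · exact Or.inr (toLex.injective h)

/-- In a finite source-free labeled graph, every `I_u` is nonempty and has both a least
and a greatest element w.r.t. the lexicographic order: the infimum and supremum strings
are well-defined and attained. -/
theorem stmt_15 (n σ : ℕ) [NeZero n] [NeZero σ]
    (E : Set (Fin n × Fin n × Fin σ))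
    (hE : ∀ u : Fin n, ∃ v c, (v, u, c) ∈ E)
    (u : Fin n) :
    (Iset E u).Nonempty ∧
    (∃ γ ∈ Iset E u, ∀ δ ∈ Iset E u, OmegaLe γ δ) ∧
    (∃ γ ∈ Iset E u, ∀ δ ∈ Iset E u, OmegaLe δ γ) := by
  let _ : TopologicalSpace (Lex (ℕ → Fin σ)) := inferInstanceAs (TopologicalSpace (ℕ → Fin σ))
  have hK : IsCompact (toLex '' Iset E u) := by
    refine (aux_Iset_compact E u).image (f := toLex) ?_
    exact continuous_id
  have hne := aux_nonempty E hE u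
  have hi : ClosedIicTopology (Lex (ℕ → Fin σ)) := ⟨fun a => by
    rw [← isOpen_compl_iff, Set.compl_Iic]
    exact aux_open (fun x y => x < y) (ofLex a)⟩
  have hj : ClosedIciTopology (Lex (ℕ → Fin σ)) := ⟨fun a => by
    rw [← isOpen_compl_iff, Set.compl_Ici]
    have h := aux_open (fun x y => y < x) (ofLex a)
    have e : {γ : ℕ → Fin σ | ∃ k : ℕ, (∀ j, j < k → ofLex a j = γ j) ∧ γ k < ofLex a k} =
        {γ : ℕ → Fin σ | ∃ k : ℕ, (∀ j, j < k → γ j = ofLex a j) ∧ γ k < ofLex a k} := by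
      ext γ
      simp only [Set.mem_setOf_eq, eq_comm]
    rw [e] at h
    exact h⟩
  refine ⟨hne, ?_, ?_⟩
  · obtain ⟨_, ⟨γ, hγ, rfl⟩, hm⟩ := hK.exists_isLeast (hne.image _)
    exact ⟨γ, hγ, fun δ hδ => aux_le (hm ⟨δ, hδ, rfl⟩)⟩
  · obtain ⟨_, ⟨γ, hγ, rfl⟩, hm⟩ := hK.exists_isGreatest (hne.image _)
    exact ⟨γ, hγ, fun δ hδ => aux_le (hm ⟨δ, hδ, rfl⟩)⟩
end
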